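/- In the hyperquotient setup with the square form and Rules I and II, the following holds. For every $\alpha\in N\cap\square$ such that $\alpha$ is different from $\beta$ and from $\beta'$ (these conditions being vacuous when $B=\emptyset$), exactly one of the following two alternatives holds: (i) $\alpha(f)=2\alpha_1\leq 1$ and $\alpha_2+\alpha_3+\alpha_4>1+\alpha_1$, and moreover if $2\alpha_1=1$ then $(\alpha_2,\alpha_3,\alpha_4)$ is a permutation of $(1/2,1/2,1)$; (ii) $\alpha(f)=2\alpha_1-1$ and $\alpha_2+\alpha_3+\alpha_4<1+\alpha_1$, and moreover if $2\alpha_1=1$ then $(\alpha_2,\alpha_3,\alpha_4)$ is a permutation of $(1/2,1/2,0)$. In particular, for every $k\in\{1,\ldots,r-1\}$ with $\alpha_k\notin\{\beta,\beta'\}$, either ($2\overline{ak}=\overline{ek}$ and $\overline{bk}+\overline{ck}+\overline{dk}=\overline{ak}+k+r$) or ($2\overline{ak}=\overline{ek}+r$ and $\overline{bk}+\overline{ck}+\overline{dk}=\overline{ak}+k$). -/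

import Mathlib

open scoped BigOperators

namespace GapPaper

/-- Least non-negative residue of `n` modulo `r` (for `r > 0`). -/
def res (r n : ℤ) : ℤ := n % r

/-- The lattice `N = ℤ⁴ + ℤ·(1/r)(a,b,c,d)` inside `ℚ⁴`. -/
def latN (r a b c d : ℤ) : Set (Fin 4 → ℚ) :=
  {v | ∃ (j : ℤ) (m : Fin 4 → ℤ), ∀ i,
    v i = ((j * ![a, b, c, d] i : ℤ) : ℚ) / (r : ℚ) + (m i : ℚ)}

/-- The positive orthant `σ`. -/
def orth : Set (Fin 4 → ℚ) := {v | ∀ i, 0 ≤ v i}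

/-- The weight `w(v) = v₁ + v₂ + v₃ + v₄`. -/
def w (v : Fin 4 → ℚ) : ℚ := ∑ i, v i

/-- `v(f)`: the infimum over the monomials `m ∈ S` of their `v`-weights. -/
noncomputable def vf (S : Set (Fin 4 → ℕ)) (v : Fin 4 → ℚ) : ℝ :=
  sInf {x : ℝ | ∃ m ∈ S, x = ∑ i : Fin 4, (m i : ℝ) * ((v i : ℚ) : ℝ)}

/-- `v` is primitive in the lattice `N`. -/
def IsPrim (r a b c d : ℤ) (v : Fin 4 → ℚ) : Prop :=
  ¬ ∃ (n : ℤ) (u : Fin 4 → ℚ), 2 ≤ n ∧ u ∈ latN r a b c d ∧ v = fun i => (n : ℚ) * u i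

/-- The excluded set `{0, e₁, e₂, e₃, e₄}`. -/
def corners : Set (Fin 4 → ℚ) :=
  {v | v = 0 ∨ ∃ i₀ : Fin 4, v = fun i => if i = i₀ then 1 else 0}

/-- Every monomial of `S` has weight `e` for the `μ_r`-action with weights
`(a, b, c, d)`. -/
def WeightCond (r a b c d e : ℤ) (S : Set (Fin 4 → ℕ)) : Prop :=
  ∀ m ∈ S, Int.ModEq r ((m 0 : ℤ) * a + (m 1 : ℤ) * b + (m 2 : ℤ) * c + (m 3 : ℤ) * d) e

/-- Rule I: `B` is a set with at most one element, whose element `β` (if any) is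
primitive and satisfies `1 - δ < w(β) - β(f) < 1`, and every lattice vector in the
orthant other than `β`, `0`, `e₁`, ..., `e₄` satisfies `w(v) - v(f) > 1`. -/
def RuleI (r a b c d : ℤ) (δ : ℝ) (S : Set (Fin 4 → ℕ)) (B : Set (Fin 4 → ℚ)) : Prop :=
  B.Subsingleton ∧ B ⊆ latN r a b c d ∩ orth ∧
    (∀ β ∈ B, IsPrim r a b c d β ∧
      1 - δ < ((w β : ℚ) : ℝ) - vf S β ∧ ((w β : ℚ) : ℝ) - vf S β < 1) ∧
    ∀ v ∈ latN r a b c d ∩ orth, v ∉ B → v ∉ corners → 1 < ((w v : ℚ) : ℝ) - vf S v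

/-- Rule II. -/
def RuleII (r a b c d e : ℤ) : Prop :=
  (Int.gcd a r ∣ Int.gcd e r) ∧ (Int.gcd b r ∣ Int.gcd e r) ∧
  (Int.gcd c r ∣ Int.gcd e r) ∧ (Int.gcd d r ∣ Int.gcd e r) ∧
  Int.gcd a (Int.gcd b r) = 1 ∧ Int.gcd a (Int.gcd c r) = 1 ∧
  Int.gcd a (Int.gcd d r) = 1 ∧ Int.gcd b (Int.gcd c r) = 1 ∧
  Int.gcd b (Int.gcd d r) = 1 ∧ Int.gcd c (Int.gcd d r) = 1 ∧
  Int.ModEq r (a + b + c + d - e) 1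

/-- The vector `α_k = (1/r)(res(ak), res(bk), res(ck), res(dk))`. -/
def alphaK (r a b c d k : ℤ) : Fin 4 → ℚ :=
  fun i => ((res r (![a, b, c, d] i * k) : ℤ) : ℚ) / (r : ℚ)

/-- The unit cube `[0,1]⁴` minus its 16 vertices. -/
def cube : Set (Fin 4 → ℚ) :=
  {v | (∀ i, 0 ≤ v i ∧ v i ≤ 1) ∧ ¬ ∀ i, v i = 0 ∨ v i = 1}

/-- The cA form: `f = xy + g(z,t)` with `g ∈ 𝔪²`. -/
def FormCA (S : Set (Fin 4 → ℕ)) : Prop :=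
  ![1, 1, 0, 0] ∈ S ∧
    ∀ m ∈ S, m ≠ ![1, 1, 0, 0] → m 0 = 0 ∧ m 1 = 0 ∧ 2 ≤ m 2 + m 3

/-- The square form: `f = x² + (terms of order ≥ 2)`. -/
def FormSq (S : Set (Fin 4 → ℕ)) : Prop :=
  ![2, 0, 0, 0] ∈ S ∧ ∀ m ∈ S, 2 ≤ m 0 + m 1 + m 2 + m 3

/-- The odd form: `f = x² + y² + g(z,t)` with `g ∈ 𝔪³`. -/
def FormOdd (S : Set (Fin 4 → ℕ)) : Prop :=
  ![2, 0, 0, 0] ∈ S ∧ ![0, 2, 0, 0] ∈ S ∧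
    ∀ m ∈ S, m ≠ ![2, 0, 0, 0] → m ≠ ![0, 2, 0, 0] →
      m 0 = 0 ∧ m 1 = 0 ∧ 3 ≤ m 2 + m 3

/-- The cD–E form: `f = x² + g(y,z,t)` with `g ∈ 𝔪³`. -/
def FormCDE (S : Set (Fin 4 → ℕ)) : Prop :=
  ![2, 0, 0, 0] ∈ S ∧ ∀ m ∈ S, m ≠ ![2, 0, 0, 0] → m 0 = 0 ∧ 3 ≤ m 1 + m 2 + m 3

def wt (m : Fin 4 → ℕ) (v : Fin 4 → ℚ) : ℚ := ∑ i, (m i : ℚ) * v i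

theorem vf_form {r a b c d e : ℤ} {S : Set (Fin 4 → ℕ)} (hr : 13 < r)
    (hwt : WeightCond r a b c d e S) (hform : FormSq S) {v : Fin 4 → ℚ}
    (hv : v ∈ latN r a b c d) (ho : ∀ i, 0 ≤ v i) :
    ∃ m ∈ S, ∃ p : ℤ, 0 ≤ p ∧ wt m v = 2 * v 0 - p ∧ 0 ≤ wt m v ∧
      vf S v = ((2 * v 0 - p : ℚ) : ℝ) := by
  obtain ⟨j, n, hjn⟩ := hv
  have hrq : (r : ℚ) ≠ 0 := by
    have : r ≠ 0 := by omega
    exact_mod_cast this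
  have key : ∀ m ∈ S, ∃ p : ℤ, wt m v = 2 * v 0 - p := by
    intro m hm
    have h1 := hwt m hm
    have h2 := hwt _ hform.1
    obtain ⟨t, ht⟩ := (h1.trans h2.symm).dvd
    simp at ht
    refine ⟨j * t + 2 * n 0 - (m 0 * n 0 + m 1 * n 1 + m 2 * n 2 + m 3 * n 3), ?_⟩
    have ht' : (2 * a - (m 0 * a + m 1 * b + m 2 * c + m 3 * d) : ℚ) = r * t := by
      exact_mod_cast ht
    have e0 := hjn 0
    have e1 := hjn 1
    have e2 := hjn 2
    have e3 := hjn 3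
    simp at e0 e1 e2 e3
    simp only [wt, Fin.sum_univ_four]
    rw [e0, e1, e2, e3]
    push_cast
    field_simp
    linear_combination (-j : ℚ) * ht'
  have nn : ∀ m, 0 ≤ wt m v := fun m =>
    Finset.sum_nonneg fun i _ => mul_nonneg (Nat.cast_nonneg _) (ho i)
  have h20 : wt ![2,0,0,0] v = 2 * v 0 := by simp [wt, Fin.sum_univ_four]
  obtain ⟨p, ⟨m, hm, hp⟩, hmax⟩ := Int.exists_greatest_of_bdd
    (P := fun p : ℤ => ∃ m ∈ S, wt m v = 2 * v 0 - p)
    ⟨⌊2 * v 0⌋, fun z ⟨m, hm, hz⟩ => by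
      rw [Int.le_floor]; have := nn m; linarith⟩
    ⟨0, _, hform.1, by simp [h20]⟩
  refine ⟨m, hm, p, hmax 0 ⟨_, hform.1, by simp [h20]⟩, hp, nn m, ?_⟩
  have cst : ∀ m, ∑ i : Fin 4, (m i : ℝ) * ((v i : ℚ) : ℝ) = ((wt m v : ℚ) : ℝ) := by
    intro m; simp [wt]
  apply IsLeast.csInf_eq
  constructor
  · exact ⟨m, hm, by rw [cst, hp]⟩
  · rintro x ⟨m', hm', rfl⟩
    rw [cst]
    obtain ⟨q, hq⟩ := key m' hm'
    have := hmax q ⟨m', hm', hq⟩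
    rw [hq]
    have : (q : ℚ) ≤ p := by exact_mod_cast this
    exact_mod_cast (by linarith : 2 * v 0 - (p:ℚ) ≤ 2 * v 0 - q)

theorem zero_coord {S : Set (Fin 4 → ℕ)} (hform : FormSq S) {m : Fin 4 → ℕ} (hm : m ∈ S)
    {v : Fin 4 → ℚ} (ho : ∀ i, 0 ≤ v i) (h0 : wt m v = 0) : ∃ i, v i = 0 := by
  by_contra! hne
  have h2 := hform.2 m hm
  have := (Finset.sum_eq_zero_iff_of_nonneg
    (fun i _ => mul_nonneg (Nat.cast_nonneg (m i)) (ho i))).1 h0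
  have z : ∀ i, m i = 0 := by
    intro i
    have := this i (Finset.mem_univ _)
    simpa [hne i] using this
  simp [z] at h2

theorem dvd_of_two {r x y j : ℤ} (h : Int.gcd x (Int.gcd y r) = 1)
    (hx : r ∣ j * x) (hy : r ∣ j * y) : r ∣ j := by
  have h1 : r ∣ j * (Int.gcd y r : ℤ) := by
    rw [Int.gcd_eq_gcd_ab]
    rw [mul_add, ← mul_assoc, mul_left_comm j r]
    exact dvd_add (Dvd.dvd.mul_right hy _) (dvd_mul_right _ _)
  have h2 : r ∣ j * (Int.gcd x (Int.gcd y r) : ℤ) := by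
    rw [Int.gcd_eq_gcd_ab, mul_add, ← mul_assoc, ← mul_assoc]
    exact dvd_add (Dvd.dvd.mul_right hx _) (Dvd.dvd.mul_right h1 _)
  simpa [h] using h2

theorem dvd_of_pair {r a b c d e j : ℤ} (hII : RuleII r a b c d e) {i i' : Fin 4} (hne : i ≠ i')
    (h1 : r ∣ j * ![a, b, c, d] i) (h2 : r ∣ j * ![a, b, c, d] i') : r ∣ j := by
  obtain ⟨-, -, -, -, hab, hac, had, hbc, hbd, hcd, -⟩ := hII
  fin_cases i <;> fin_cases i' <;> simp at hne h1 h2 <;>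
  first
  | exact dvd_of_two hab h1 h2
  | exact dvd_of_two hac h1 h2
  | exact dvd_of_two had h1 h2
  | exact dvd_of_two hbc h1 h2
  | exact dvd_of_two hbd h1 h2
  | exact dvd_of_two hcd h1 h2
  | exact dvd_of_two hab h2 h1
  | exact dvd_of_two hac h2 h1
  | exact dvd_of_two had h2 h1
  | exact dvd_of_two hbc h2 h1
  | exact dvd_of_two hbd h2 h1
  | exact dvd_of_two hcd h2 h1

theorem int_all {r a b c d e : ℤ} (hr : 13 < r) (hII : RuleII r a b c d e) {v : Fin 4 → ℚ}
    (hv : v ∈ latN r a b c d) {i i' : Fin 4} (hne : i ≠ i') {n n' : ℤ}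
    (hi : v i = n) (hi' : v i' = n') (l : Fin 4) : ∃ z : ℤ, v l = z := by
  obtain ⟨j, m, hjm⟩ := hv
  have hrq : (r : ℚ) ≠ 0 := by
    have : r ≠ 0 := by omega
    exact_mod_cast this
  have aux : ∀ (i : Fin 4) (n : ℤ), v i = n → r ∣ j * ![a, b, c, d] i := by
    intro i n h
    rw [hjm i] at h
    refine ⟨n - m i, ?_⟩
    have : ((j * ![a, b, c, d] i : ℤ) : ℚ) = r * (n - m i) := by
      rw [← h]; field_simp; ring
    exact_mod_cast this
  obtain ⟨t, rfl⟩ := dvd_of_pair hII hne (aux i n hi) (aux i' n' hi')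
  refine ⟨t * ![a, b, c, d] l + m l, ?_⟩
  rw [hjm l]
  push_cast
  field_simp

theorem no_two {r a b c d e : ℤ} (hr : 13 < r) (hII : RuleII r a b c d e) {v : Fin 4 → ℚ}
    (hv : v ∈ latN r a b c d) (hc : v ∈ cube) {i i' : Fin 4} (hne : i ≠ i') {n n' : ℤ}
    (hi : v i = n) (hi' : v i' = n') : False := by
  apply hc.2
  intro l
  obtain ⟨z, hz⟩ := int_all hr hII hv hne hi hi' l
  have := hc.1 l
  rw [hz] at this ⊢
  have h1 : 0 ≤ z := by exact_mod_cast this.1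
  have h2 : z ≤ 1 := by exact_mod_cast this.2
  have : z = 0 ∨ z = 1 := by omega
  exact_mod_cast this

theorem half {r a b c d e : ℤ} (hr : 13 < r) (hII : RuleII r a b c d e) {v : Fin 4 → ℚ}
    (hv : v ∈ latN r a b c d) (hc : v ∈ cube) {i : Fin 4} (hne : i ≠ 0) {n : ℤ}
    (h0 : v 0 = 1 / 2) (hi : v i = n) (l : Fin 4) (hl : l ≠ i) : v l = 1 / 2 := by
  have h2 : (fun i => 2 * v i) ∈ latN r a b c d := by
    obtain ⟨j, m, hjm⟩ := hv
    refine ⟨2 * j, fun i => 2 * m i, fun i => ?_⟩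
    simp only [hjm i]
    push_cast
    ring
  obtain ⟨z, hz⟩ := int_all hr hII h2 hne (n := 2 * n) (n' := 1)
    (by simp [hi]) (by simp [h0]) l
  have := hc.1 l
  have h1 : (0 : ℚ) ≤ z := by linarith
  have h3 : (z : ℚ) ≤ 2 := by linarith
  have h1 : 0 ≤ z := by exact_mod_cast h1
  have h3 : z ≤ 2 := by exact_mod_cast h3
  have : z = 0 ∨ z = 1 ∨ z = 2 := by omega
  rcases this with rfl | rfl | rfl
  · exact (no_two hr hII hv hc hl (n := 0) (n' := n) (by push_cast at *; linarith) hi).elim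
  · push_cast at hz; linarith
  · exact (no_two hr hII hv hc hl (n := 1) (n' := n) (by push_cast at *; linarith) hi).elim

theorem perm_half {r a b c d e : ℤ} (hr : 13 < r) (hII : RuleII r a b c d e) {v : Fin 4 → ℚ}
    (hv : v ∈ latN r a b c d) (hc : v ∈ cube) {i : Fin 4} {n : ℤ}
    (h0 : v 0 = 1 / 2) (hi : v i = n) :
    List.Perm [v 1, v 2, v 3] ([1/2, 1/2, (n : ℚ)] : List ℚ) := by
  have hne : i ≠ 0 := by
    rintro rfl
    rw [h0] at hi
    have : ((1 : ℤ) : ℚ) = ((2 * n : ℤ) : ℚ) := by push_cast; linarith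
    have := Int.cast_injective this
    omega
  have H := half hr hII hv hc hne h0 hi
  fin_cases i
  · simp at hne
  · have h2 := H 2 (by decide)
    have h3 := H 3 (by decide)
    simp at hi
    rw [hi, h2, h3]
    exact (List.perm_append_comm (l₁ := [(n : ℚ)]) (l₂ := [1/2, 1/2]))
  · have h2 := H 1 (by decide)
    have h3 := H 3 (by decide)
    simp at hi
    rw [hi, h2, h3]
    exact List.Perm.cons _ (List.Perm.swap _ _ _)
  · have h2 := H 1 (by decide)
    have h3 := H 2 (by decide)
    simp at hi
    rw [hi, h2, h3]

theorem cube_compl {v : Fin 4 → ℚ} (hc : v ∈ cube) : (fun i => 1 - v i) ∈ cube := by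
  refine ⟨fun i => ?_, fun h => hc.2 fun i => ?_⟩
  · have := hc.1 i
    constructor <;> simp <;> linarith
  · rcases h i with h | h
    · right; linarith
    · left; linarith

theorem cube_not_corner {v : Fin 4 → ℚ} (hc : v ∈ cube) : v ∉ corners := by
  rintro (rfl | ⟨i₀, rfl⟩)
  · exact hc.2 fun i => Or.inl rfl
  · refine hc.2 fun i => ?_
    by_cases h : i = i₀ <;> simp [h]

theorem lat_compl {r a b c d : ℤ} {v : Fin 4 → ℚ} (hv : v ∈ latN r a b c d) :
    (fun i => 1 - v i) ∈ latN r a b c d := by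
  obtain ⟨j, m, hjm⟩ := hv
  refine ⟨-j, fun i => 1 - m i, fun i => ?_⟩
  simp only [hjm i]
  push_cast
  ring

theorem core {r : ℤ} {δ : ℝ} {a b c d e : ℤ} {S : Set (Fin 4 → ℕ)}
    {B : Set (Fin 4 → ℚ)} (hr : 13 < r) (hwt : WeightCond r a b c d e S)
    (hI : RuleI r a b c d δ S B) (hII : RuleII r a b c d e) (hform : FormSq S)
    {α : Fin 4 → ℚ} (hα : α ∈ latN r a b c d) (hc : α ∈ cube)
    (hβ : ∀ β ∈ B, α ≠ β ∧ α ≠ fun i => 1 - β i) :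
    (vf S α = ((2 * α 0 : ℚ) : ℝ) ∧ 2 * α 0 ≤ 1 ∧
      1 + α 0 < α 1 + α 2 + α 3 ∧ α 1 + α 2 + α 3 < 2 + α 0 ∧
      (2 * α 0 = 1 → List.Perm [α 1, α 2, α 3] ([1/2, 1/2, 1] : List ℚ))) ∨
    (vf S α = ((2 * α 0 : ℚ) : ℝ) - 1 ∧ 1 ≤ 2 * α 0 ∧
      α 0 < α 1 + α 2 + α 3 ∧ α 1 + α 2 + α 3 < 1 + α 0 ∧
      (2 * α 0 = 1 → List.Perm [α 1, α 2, α 3] ([1/2, 1/2, 0] : List ℚ))) := by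
  have hα' := lat_compl hα
  have hc' := cube_compl hc
  have ho : ∀ i, 0 ≤ α i := fun i => (hc.1 i).1
  have ho' : ∀ i, 0 ≤ (fun i => 1 - α i) i := fun i => (hc'.1 i).1
  obtain ⟨m, hm, p, hp0, hp, hpn, hvf⟩ := vf_form hr hwt hform hα ho
  obtain ⟨m', hm', q, hq0, hq, hqn, hvf'⟩ := vf_form hr hwt hform hα' ho'
  have I1 := hI.2.2.2 α ⟨hα, ho⟩ (fun h => (hβ _ h).1 rfl) (cube_not_corner hc)
  have I2 := hI.2.2.2 _ ⟨hα', ho'⟩ (fun h => (hβ _ h).2 (by funext i; simp))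
    (cube_not_corner hc')
  rw [hvf] at I1
  rw [hvf'] at I2
  have I1 : 1 < w α - (2 * α 0 - p) := by exact_mod_cast I1
  have I2 : 1 < w (fun i => 1 - α i) - (2 * (1 - α 0) - q) := by exact_mod_cast I2
  simp only [w, Fin.sum_univ_four] at I1 I2
  rw [hp] at hpn
  rw [hq] at hqn
  have s1 : (0 : ℚ) < p + q := by linarith
  have s2 : (p : ℚ) + q ≤ 2 := by linarith
  have s1 : 0 < p + q := by exact_mod_cast s1
  have s2 : p + q ≤ 2 := by exact_mod_cast s2
  have Z1 : 2 * α 0 - p = 0 → ∃ i, α i = 0 := fun h => zero_coord hform hm ho (by rw [hp, h])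
  have Z2 : 2 * (1 - α 0) - q = 0 → ∃ i, α i = 1 := fun h => by
    obtain ⟨i, hi⟩ := zero_coord hform hm' ho' (by rw [hq]; exact h)
    exact ⟨i, by linarith⟩
  have cases5 : (p = 0 ∧ q = 1) ∨ (p = 1 ∧ q = 0) ∨ (p = 2 ∧ q = 0) ∨ (p = 0 ∧ q = 2)
    ∨ (p = 1 ∧ q = 1) := by omega
  rcases cases5 with ⟨rfl, rfl⟩ | ⟨rfl, rfl⟩ | ⟨rfl, rfl⟩ | ⟨rfl, rfl⟩ | ⟨rfl, rfl⟩ <;>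
    push_cast at *
  · left
    refine ⟨by rw [hvf]; simp, by linarith, by linarith, by linarith, fun h => ?_⟩
    obtain ⟨i, hi⟩ := Z2 (by linarith)
    simpa using perm_half hr hII hα hc (n := 1) (by linarith) (by simpa using hi)
  · right
    refine ⟨by rw [hvf], by linarith, by linarith, by linarith, fun h => ?_⟩
    obtain ⟨i, hi⟩ := Z1 (by linarith)
    simpa using perm_half hr hII hα hc (n := 0) (by linarith) (by simpa using hi)
  · exfalso
    have h0 : α 0 = 1 := by linarith
    obtain ⟨i, hi⟩ := Z1 (by linarith)
    have hne : i ≠ 0 := by rintro rfl; linarith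
    exact no_two hr hII hα hc hne (n := 0) (n' := 1) (by simpa using hi) (by simpa using h0)
  · exfalso
    have h0 : α 0 = 0 := by linarith
    obtain ⟨i, hi⟩ := Z2 (by linarith)
    have hne : i ≠ 0 := by rintro rfl; linarith
    exact no_two hr hII hα hc hne (n := 1) (n' := 0) (by simpa using hi) (by simpa using h0)
  · exfalso
    obtain ⟨i, hi⟩ := Z1 (by linarith)
    obtain ⟨i', hi'⟩ := Z2 (by linarith)
    have hne : i ≠ i' := by rintro rfl; linarith
    exact no_two hr hII hα hc hne (n := 0) (n' := 1) (by simpa using hi) (by simpa using hi')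

theorem alphaK_lat {r a b c d k : ℤ} (hr : 13 < r) : alphaK r a b c d k ∈ latN r a b c d := by
  have hrq : (r : ℚ) ≠ 0 := by
    have : r ≠ 0 := by omega
    exact_mod_cast this
  refine ⟨k, fun i => - ((![a, b, c, d] i * k) / r), fun i => ?_⟩
  have h : (((![a, b, c, d] i * k) % r : ℤ) : ℚ) + r * (((![a, b, c, d] i * k) / r : ℤ) : ℚ)
      = ((![a, b, c, d] i * k : ℤ) : ℚ) := by
    exact_mod_cast Int.emod_add_mul_ediv (![a, b, c, d] i * k) r
  simp only [alphaK, res]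
  rw [mul_comm k, ← h]
  push_cast
  field_simp
  ring

theorem alphaK_cube {r a b c d e k : ℤ} (hr : 13 < r) (hII : RuleII r a b c d e)
    (h1 : 1 ≤ k) (h2 : k ≤ r - 1) : alphaK r a b c d k ∈ cube := by
  have hrq : (0 : ℚ) < r := by
    have : 0 < r := by omega
    exact_mod_cast this
  have lt : ∀ i, alphaK r a b c d k i < 1 := by
    intro i
    simp only [alphaK, res]
    rw [div_lt_one hrq]
    exact_mod_cast Int.emod_lt_of_pos _ (by omega)
  refine ⟨fun i => ⟨?_, (lt i).le⟩, fun h => ?_⟩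
  · simp only [alphaK, res]
    apply div_nonneg _ hrq.le
    exact_mod_cast Int.emod_nonneg _ (by omega)
  · have z : ∀ i, r ∣ k * ![a, b, c, d] i := by
      intro i
      have h0 : alphaK r a b c d k i = 0 := (h i).resolve_right (lt i).ne
      simp only [alphaK, res] at h0
      rw [div_eq_zero_iff] at h0
      have h0 := h0.resolve_right hrq.ne'
      have h0 : (![a, b, c, d] i * k) % r = 0 := by exact_mod_cast h0
      rw [mul_comm]
      exact Int.dvd_of_emod_eq_zero h0
    have := dvd_of_pair hII (i := 0) (i' := 1) (by decide) (z 0) (z 1)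
    have := Int.le_of_dvd (by omega) this
    omega

/-- Proposition (x²), part (1) and its consequence, in the square case. -/
theorem statement11 (r : ℤ) (δ : ℝ) (a b c d e : ℤ) (S : Set (Fin 4 → ℕ))
    (B : Set (Fin 4 → ℚ))
    (hr : 13 < r) (hδ0 : 0 < δ) (hδ1 : δ ≤ 1 / 13)
    (hwt : WeightCond r a b c d e S)
    (hI : RuleI r a b c d δ S B) (hII : RuleII r a b c d e)
    (hform : FormSq S) :
    (∀ α ∈ latN r a b c d ∩ cube,
      (∀ β ∈ B, α ≠ β ∧ α ≠ fun i => 1 - β i) →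
      Xor'
        (vf S α = ((2 * α 0 : ℚ) : ℝ) ∧ 2 * α 0 ≤ 1 ∧
          1 + α 0 < α 1 + α 2 + α 3 ∧
          (2 * α 0 = 1 → List.Perm [α 1, α 2, α 3] ([1/2, 1/2, 1] : List ℚ)))
        (vf S α = ((2 * α 0 : ℚ) : ℝ) - 1 ∧ α 1 + α 2 + α 3 < 1 + α 0 ∧
          (2 * α 0 = 1 → List.Perm [α 1, α 2, α 3] ([1/2, 1/2, 0] : List ℚ)))) ∧
    ∀ k : ℤ, 1 ≤ k → k ≤ r - 1 →
      (∀ β ∈ B, alphaK r a b c d k ≠ β ∧ alphaK r a b c d k ≠ fun i => 1 - β i) →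
      (2 * res r (a * k) = res r (e * k) ∧
        res r (b * k) + res r (c * k) + res r (d * k) = res r (a * k) + k + r) ∨
      (2 * res r (a * k) = res r (e * k) + r ∧
        res r (b * k) + res r (c * k) + res r (d * k) = res r (a * k) + k) := by
  refine ⟨fun α hα hβ => ?_, fun k hk1 hk2 hβ => ?_⟩
  · rcases core hr hwt hI hII hform hα.1 hα.2 hβ with ⟨h1, h2, h3, h4, h5⟩ | ⟨h1, h2, h3, h4, h5⟩
    · exact Or.inl ⟨⟨h1, h2, h3, h5⟩, fun h => by linarith [h.2.1]⟩
    · exact Or.inr ⟨⟨h1, h4, h5⟩, fun h => by linarith [h.2.2.1]⟩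
  · have hrq : (0 : ℚ) < r := by
      have : 0 < r := by omega
      exact_mod_cast this
    have h2a := hwt _ hform.1
    simp at h2a
    have hsum := hII.2.2.2.2.2.2.2.2.2.2
    have E : Int.ModEq r (2 * res r (a * k)) (e * k) := by
      have h : Int.ModEq r (res r (a * k)) (a * k) := Int.mod_modEq _ _
      have := (h.mul_left 2).trans (by simpa [mul_assoc] using h2a.mul_right k)
      exact this
    have F : Int.ModEq r (res r (b * k) + res r (c * k) + res r (d * k))
        (res r (a * k) + k) := by
      have ha : Int.ModEq r (res r (a * k)) (a * k) := Int.mod_modEq _ _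
      have hb : Int.ModEq r (res r (b * k)) (b * k) := Int.mod_modEq _ _
      have hc : Int.ModEq r (res r (c * k)) (c * k) := Int.mod_modEq _ _
      have hd : Int.ModEq r (res r (d * k)) (d * k) := Int.mod_modEq _ _
      refine ((hb.add hc).add hd).trans (Int.ModEq.trans ?_ (ha.add_right k).symm)
      obtain ⟨t, ht⟩ := hsum.dvd
      obtain ⟨u, hu⟩ := h2a.dvd
      rw [Int.modEq_iff_dvd]
      exact ⟨t * k - u * k, by linear_combination k * ht - k * hu⟩
    have e0 : 0 ≤ res r (e * k) := Int.emod_nonneg _ (by omega)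
    have e1 : res r (e * k) < r := Int.emod_lt_of_pos _ (by omega)
    have l1 : res r (b * k) < r := Int.emod_lt_of_pos _ (by omega)
    have l2 : res r (c * k) < r := Int.emod_lt_of_pos _ (by omega)
    have l3 : res r (d * k) < r := Int.emod_lt_of_pos _ (by omega)
    have a0 : 0 ≤ res r (a * k) := Int.emod_nonneg _ (by omega)
    have a1 : res r (a * k) < r := Int.emod_lt_of_pos _ (by omega)
    have E' := Int.ModEq.trans E (Int.mod_modEq (e * k) r).symm
    change Int.ModEq r (2 * res r (a * k)) (res r (e * k)) at E'
    obtain ⟨t, ht⟩ := E'.symm.dvd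
    obtain ⟨u, hu⟩ := F.symm.dvd
    have v0 : alphaK r a b c d k 0 = (res r (a * k) : ℚ) / r := by simp [alphaK]
    have v1 : alphaK r a b c d k 1 = (res r (b * k) : ℚ) / r := by simp [alphaK]
    have v2 : alphaK r a b c d k 2 = (res r (c * k) : ℚ) / r := by simp [alphaK]
    have v3 : alphaK r a b c d k 3 = (res r (d * k) : ℚ) / r := by simp [alphaK]
    have H := core hr hwt hI hII hform (alphaK_lat hr) (alphaK_cube hr hII hk1 hk2) hβ
    rw [v0, v1, v2, v3] at H
    generalize res r (a * k) = A at *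
    generalize res r (b * k) = X at *
    generalize res r (c * k) = Y at *
    generalize res r (d * k) = Z at *
    generalize res r (e * k) = W at *
    rcases H with ⟨-, h2, h3, h4, h5⟩ | ⟨-, h2, h3, h4, -⟩
    · left
      have hA : 2 * A ≠ r := by
        intro h
        have hq : (2 * A : ℚ) = r := by exact_mod_cast h
        have hp := h5 (by field_simp; linarith)
        have hmem : (1 : ℚ) ∈ [(X : ℚ) / r, (Y : ℚ) / r, (Z : ℚ) / r] := by
          rw [hp.mem_iff]; simp
        have x1 : (X : ℚ) / r < 1 := by rw [div_lt_one hrq]; exact_mod_cast l1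
        have x2 : (Y : ℚ) / r < 1 := by rw [div_lt_one hrq]; exact_mod_cast l2
        have x3 : (Z : ℚ) / r < 1 := by rw [div_lt_one hrq]; exact_mod_cast l3
        simp at hmem
        rcases hmem with h | h | h <;> linarith
      field_simp at h2 h3 h4
      have h2 : 2 * A ≤ r := by exact_mod_cast h2
      have h3 : r + A < X + Y + Z := by exact_mod_cast h3
      have h4 : X + Y + Z < 2 * r + A := by exact_mod_cast (by linarith : (X + Y + Z : ℚ) < 2 * r + A)
      have ht0 : t = 0 := by
        have : t < 1 := by by_contra! h; nlinarith [lt_of_le_of_ne h2 hA]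
        have : -1 < t := by by_contra! h; nlinarith
        omega
      have hu1 : u = 1 := by
        have : u < 2 := by by_contra! h; nlinarith
        have : 0 < u := by by_contra! h; nlinarith
        omega
      subst ht0 hu1
      constructor <;> linarith
    · right
      field_simp at h2 h3 h4
      have h2 : r ≤ 2 * A := by exact_mod_cast h2
      have h3 : A < X + Y + Z := by exact_mod_cast h3
      have h4 : X + Y + Z < r + A := by exact_mod_cast h4
      have ht0 : t = 1 := by
        have : t < 2 := by by_contra! h; nlinarith
        have : 0 < t := by by_contra! h; nlinarith
        omega
      have hu1 : u = 0 := by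
        have : u < 1 := by by_contra! h; nlinarith
        have : -1 < u := by by_contra! h; nlinarith
        omega
      subst ht0 hu1
      constructor <;> linarith

end GapPaper
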